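/- arXiv:0803.3094 — 7 statements merged into one kernel-verified Lean document; each statement's English description precedes it below -/
import Mathlib

section
/- Let k ≥ 2 and let χ_1, …, χ_{k+1} be nonzero linear functionals on ℝ^k whose kernels are distinct hyperplanes through the origin in general position, and let (a_1, …, a_{k+1}) be a nonzero vector with a_1·χ_1 + ⋯ + a_{k+1}·χ_{k+1} = 0 (so all a_i ≠ 0). Then for a sign vector σ ∈ {−1, 1}^{k+1}, there exists t ∈ ℝ^k with σ_i·χ_i(t) > 0 for all i = 1, …, k+1 if and only if σ is neither the sign vector (sign(a_1), …, sign(a_{k+1})) nor its negative. -/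
/-- If the kernels of every `k` of the `k + 1` functionals meet in a zero-dimensional space, then
the values of all functionals but one can be prescribed. -/
theorem exists_forall_succAbove_apply_eq {k : ℕ} (χ : Fin (k + 1) → ((Fin k → ℝ) →ₗ[ℝ] ℝ))
    (hgp : ∀ S : Finset (Fin (k + 1)),
      Module.finrank ℝ ↥(⨅ i ∈ S, LinearMap.ker (χ i)) = k - S.card)
    (j : Fin (k + 1)) (b : Fin k → ℝ) :
    ∃ t : Fin k → ℝ, ∀ i, χ (j.succAbove i) t = b i := by
  have hinj : Function.Injective (LinearMap.pi fun i : Fin k => χ (j.succAbove i)) := by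
    rw [← LinearMap.ker_eq_bot, LinearMap.ker_pi]
    have h := hgp (Finset.univ.map j.succAboveEmb)
    rw [Finset.card_map, Finset.card_univ, Fintype.card_fin, Nat.sub_self,
      Submodule.finrank_eq_zero] at h
    rw [← h]
    simp only [Finset.mem_map, Finset.mem_univ, true_and, iInf_exists,
      Fin.coe_succAboveEmb]
    rw [iInf_comm]
    simp
  obtain ⟨t, ht⟩ := LinearMap.injective_iff_surjective.mp hinj b
  exact ⟨t, fun i => congrFun ht i⟩

/-- A nontrivial relation has no zero coefficient if the values of all functionals but one can be
prescribed. -/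
theorem relation_coeff_ne_zero {k : ℕ} {V : Type*} (f : Fin (k + 1) → V → ℝ)
    (hf : ∀ (j : Fin (k + 1)) (b : Fin k → ℝ), ∃ t, ∀ i, f (j.succAbove i) t = b i)
    (a : Fin (k + 1) → ℝ) (ha : a ≠ 0) (hrel : ∀ t, ∑ i, a i * f i t = 0) (j : Fin (k + 1)) :
    a j ≠ 0 := by
  intro hj
  refine ha (funext fun i => ?_)
  rcases Fin.eq_self_or_eq_succAbove j i with rfl | ⟨l, rfl⟩
  · exact hj
  · obtain ⟨t, ht⟩ := hf j (Pi.single l 1)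
    have h := hrel t
    rw [Fin.sum_univ_succAbove _ j] at h
    simpa [hj, ht, Pi.single_apply] using h

/-- Signs that agree with the relation at one index and disagree at another can be realized. -/
theorem exists_pos_of_neg_of_pos {k : ℕ} {V : Type*} (f : Fin (k + 1) → V → ℝ)
    (hf : ∀ (j : Fin (k + 1)) (b : Fin k → ℝ), ∃ t, ∀ i, f (j.succAbove i) t = b i)
    (a : Fin (k + 1) → ℝ) (hrel : ∀ t, ∑ i, a i * f i t = 0)
    (σ : Fin (k + 1) → ℝ) (hσ : ∀ i, σ i * σ i = 1) {p q : Fin (k + 1)}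
    (hp : σ p * a p < 0) (hq : 0 < σ q * a q) :
    ∃ t, ∀ i, 0 < σ i * f i t := by
  rcases Fin.eq_self_or_eq_succAbove p q with rfl | ⟨l, rfl⟩
  · exact absurd hp hq.not_gt
  set s : ℝ := ∑ i, σ (p.succAbove i) * a (p.succAbove i) with hs
  set M : ℝ := (|s| + 1) / (σ (p.succAbove l) * a (p.succAbove l)) with hM
  have hM0 : 0 < M := by positivity
  obtain ⟨t, ht⟩ := hf p fun i => σ (p.succAbove i) * (1 + if i = l then M else 0)
  have hsum : ∑ i, a (p.succAbove i) * f (p.succAbove i) t = s + (|s| + 1) := by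
    have hMc : σ (p.succAbove l) * a (p.succAbove l) * M = |s| + 1 := by
      rw [hM, mul_div_cancel₀ _ hq.ne']
    rw [← hMc, hs]
    simp only [ht]
    trans ∑ i, (σ (p.succAbove i) * a (p.succAbove i) +
      if i = l then σ (p.succAbove i) * a (p.succAbove i) * M else 0)
    · refine Finset.sum_congr rfl fun i _ => ?_
      split_ifs <;> ring
    · rw [Finset.sum_add_distrib, Finset.sum_ite_eq' Finset.univ l, if_pos (Finset.mem_univ l)]
  have h := hrel t
  rw [Fin.sum_univ_succAbove _ p, hsum] at h
  refine ⟨t, fun i => ?_⟩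
  rcases Fin.eq_self_or_eq_succAbove p i with rfl | ⟨m, rfl⟩
  · have h1 : (σ i * a i) * (σ i * f i t) < 0 := by
      have h2 : (σ i * a i) * (σ i * f i t) = a i * f i t := by
        linear_combination (a i * f i t) * hσ i
      linarith [neg_abs_le s]
    exact pos_of_mul_neg_right h1 hp.le
  · rw [ht, ← mul_assoc, hσ, one_mul]
    split_ifs <;> linarith

/-- The sign vector of a relation is not realized. -/
theorem not_forall_sign_mul_pos {ι : Type*} [Fintype ι] [Nonempty ι] (a x : ι → ℝ)
    (h : ∑ i, a i * x i = 0) : ¬ ∀ i, 0 < Real.sign (a i) * x i := by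
  intro hx
  refine (Finset.sum_pos (fun i _ => ?_) Finset.univ_nonempty).ne' h
  have hi := hx i
  rcases lt_trichotomy (a i) 0 with h0 | h0 | h0
  · rw [Real.sign_of_neg h0] at hi
    nlinarith
  · simp [h0] at hi
  · rw [Real.sign_of_pos h0] at hi
    nlinarith

/-- given nonzero functionals `χ i` on `ℝ^k` with distinct kernels in
general position and a nonzero linear relation `a`, a combination of signs `σ` is
realized by some `t` (i.e. `σ i * χ i t > 0` for all `i`) if and only if `σ` is neither
the sign vector of `a` nor its negative. -/
theorem statement1 (k : ℕ) (hk : 2 ≤ k)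
    (χ : Fin (k + 1) → ((Fin k → ℝ) →ₗ[ℝ] ℝ))
    (hne : ∀ i, χ i ≠ 0)
    (hdist : ∀ i j, i ≠ j → LinearMap.ker (χ i) ≠ LinearMap.ker (χ j))
    (hgp : ∀ S : Finset (Fin (k + 1)),
      Module.finrank ℝ ↥(⨅ i ∈ S, LinearMap.ker (χ i)) = k - S.card)
    (a : Fin (k + 1) → ℝ) (ha : a ≠ 0) (hrel : ∑ i, a i • χ i = 0)
    (σ : Fin (k + 1) → ℝ) (hσ : ∀ i, σ i = 1 ∨ σ i = -1) :
    (∃ t : Fin k → ℝ, ∀ i, 0 < σ i * χ i t) ↔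
      (σ ≠ fun i => Real.sign (a i)) ∧ (σ ≠ fun i => -Real.sign (a i)) := by
  have hrel' : ∀ t, ∑ i, a i * χ i t = 0 := fun t => by
    simpa using LinearMap.congr_fun hrel t
  constructor
  · rintro ⟨t, ht⟩
    refine ⟨?_, ?_⟩
    · rintro rfl
      exact not_forall_sign_mul_pos a (fun i => χ i t) (hrel' t) ht
    · rintro rfl
      refine not_forall_sign_mul_pos a (fun i => χ i (-t)) (hrel' (-t)) fun i => ?_
      simpa using ht i
  · rintro ⟨h1, h2⟩
    have hsurj := exists_forall_succAbove_apply_eq χ hgp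
    have ha0 := relation_coeff_ne_zero (fun i => χ i) hsurj a ha hrel'
    obtain ⟨p, hp⟩ := Function.ne_iff.mp h1
    obtain ⟨q, hq⟩ := Function.ne_iff.mp h2
    refine exists_pos_of_neg_of_pos (fun i => χ i) hsurj a hrel' σ
      (fun i => by rcases hσ i with h | h <;> simp [h]) (p := p) (q := q) ?_ ?_
    · rcases (ha0 p).lt_or_gt with h0 | h0 <;> rcases hσ p with h | h <;>
        simp_all [Real.sign_of_neg, Real.sign_of_pos]
    · rcases (ha0 q).lt_or_gt with h0 | h0 <;> rcases hσ q with h | h <;>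
        simp_all [Real.sign_of_neg, Real.sign_of_pos]
end

section
/- Let k ≥ 2 and let χ_1, …, χ_{k+1} be nonzero linear functionals on ℝ^k whose kernels are distinct hyperplanes through the origin in general position. Then the complement ℝ^k \ (ker χ_1 ∪ ⋯ ∪ ker χ_{k+1}) has exactly 2^{k+1} − 2 connected components, and every connected component is of the form {t ∈ ℝ^k : σ_i·χ_i(t) > 0 for all i = 1, …, k+1} for some sign vector σ ∈ {−1, 1}^{k+1}. -/
open Module

section Chamber

variable {ι V : Type*} [AddCommGroup V] [Module ℝ V]

/-- The points at which every functional `χ i` is nonzero with sign `σ i`. -/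
def signChamber (χ : ι → V →ₗ[ℝ] ℝ) (σ : ι → ℤˣ) : Set V :=
  {s | ∀ i, 0 < ((σ i : ℤ) : ℝ) * χ i s}

/-- The sign of a real number as a unit of `ℤ`, with value `-1` at `0`. -/
noncomputable def unitSign (x : ℝ) : ℤˣ := if 0 < x then 1 else -1

theorem unitSign_mul_pos {x : ℝ} (hx : x ≠ 0) : 0 < ((unitSign x : ℤ) : ℝ) * x := by
  unfold unitSign
  split_ifs with h
  · simpa using h
  · simpa using lt_of_le_of_ne (not_lt.mp h) hx

theorem eq_unitSign_of_mul_pos {u : ℤˣ} {x : ℝ} (h : 0 < ((u : ℤ) : ℝ) * x) :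
    u = unitSign x := by
  unfold unitSign
  rcases Int.units_eq_one_or u with rfl | rfl
  · simp only [Units.val_one, Int.cast_one, one_mul] at h
    simp [h]
  · simp only [Units.val_neg, Units.val_one, Int.cast_neg, Int.cast_one, neg_mul, one_mul,
      Left.neg_pos_iff] at h
    simp [not_lt.mpr h.le]

theorem eq_of_mem_signChamber {χ : ι → V →ₗ[ℝ] ℝ} {σ τ : ι → ℤˣ} {s : V}
    (hσ : s ∈ signChamber χ σ) (hτ : s ∈ signChamber χ τ) : σ = τ :=
  funext fun i => (eq_unitSign_of_mul_pos (hσ i)).trans (eq_unitSign_of_mul_pos (hτ i)).symm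

theorem mem_signChamber_unitSign {χ : ι → V →ₗ[ℝ] ℝ} {s : V} (hs : ∀ i, χ i s ≠ 0) :
    s ∈ signChamber χ fun i => unitSign (χ i s) :=
  fun i => unitSign_mul_pos (hs i)

theorem convex_signChamber (χ : ι → V →ₗ[ℝ] ℝ) (σ : ι → ℤˣ) : Convex ℝ (signChamber χ σ) := by
  have h : signChamber χ σ = ⋂ i, {s | 0 < (((σ i : ℤ) : ℝ) • χ i) s} := by
    ext s
    simp [signChamber]
  rw [h]
  exact convex_iInter fun i => convex_halfSpace_gt (LinearMap.isLinear _) 0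

theorem mem_compl_iUnion_ker {χ : ι → V →ₗ[ℝ] ℝ} {s : V} :
    s ∈ (⋃ i, (LinearMap.ker (χ i) : Set V))ᶜ ↔ ∀ i, χ i s ≠ 0 := by
  simp

theorem signChamber_subset (χ : ι → V →ₗ[ℝ] ℝ) (σ : ι → ℤˣ) :
    signChamber χ σ ⊆ (⋃ i, (LinearMap.ker (χ i) : Set V))ᶜ :=
  fun _ hs => mem_compl_iUnion_ker.mpr fun i => right_ne_zero_of_mul (hs i).ne'

theorem connectedComponentIn_eq_signChamber [TopologicalSpace V] [IsTopologicalAddGroup V]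
    [ContinuousSMul ℝ V] {χ : ι → V →ₗ[ℝ] ℝ} (hχ : ∀ i, Continuous (χ i)) {σ : ι → ℤˣ} {t : V}
    (ht : t ∈ signChamber χ σ) :
    connectedComponentIn (⋃ i, (LinearMap.ker (χ i) : Set V))ᶜ t = signChamber χ σ := by
  have htU := signChamber_subset χ σ ht
  refine Set.Subset.antisymm (fun s hs i => ?_)
    ((convex_signChamber χ σ).isPreconnected.subset_connectedComponentIn ht
      (signChamber_subset χ σ))
  by_contra hneg
  have hcont : Continuous fun x => ((σ i : ℤ) : ℝ) * χ i x := continuous_const.mul (hχ i)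
  obtain ⟨x, hx, hx0⟩ := isPreconnected_connectedComponentIn.intermediate_value hs
    (mem_connectedComponentIn htU) hcont.continuousOn ⟨not_lt.mp hneg, (ht i).le⟩
  have hσ : ((σ i : ℤ) : ℝ) ≠ 0 := by simp
  exact mem_compl_iUnion_ker.mp (connectedComponentIn_subset _ _ hx) i
    ((mul_eq_zero.mp hx0).resolve_left hσ)

end Chamber

/-- A relation `∑ i, c i * x i = 0` with nonzero coefficients admits a solution with signs `σ`
exactly when `σ` is neither the sign vector of `c` nor its opposite. -/
theorem exists_sum_eq_zero_with_signs_iff {ι : Type*} [Fintype ι] [Nonempty ι] {c : ι → ℝ}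
    (hc : ∀ i, c i ≠ 0) (σ : ι → ℤˣ) :
    (∃ x : ι → ℝ, (∀ i, 0 < ((σ i : ℤ) : ℝ) * x i) ∧ ∑ i, x i * c i = 0) ↔
      σ ≠ (fun i => unitSign (c i)) ∧ σ ≠ -(fun i => unitSign (c i)) := by
  have hsq (u : ℤˣ) : ((u : ℤ) : ℝ) * ((u : ℤ) : ℝ) = 1 := by
    rcases Int.units_eq_one_or u with rfl | rfl <;> simp
  constructor
  · rintro ⟨x, hx, hsum⟩
    have hpos (i) : 0 < (((σ i : ℤ) : ℝ) * x i) * (((unitSign (c i) : ℤ) : ℝ) * c i) :=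
      mul_pos (hx i) (unitSign_mul_pos (hc i))
    constructor
    · rintro rfl
      refine (Finset.sum_pos (fun i _ => ?_) Finset.univ_nonempty).ne' hsum
      have := hpos i
      have h1 := hsq (unitSign (c i))
      linear_combination this + x i * c i * h1
    · rintro rfl
      refine (Finset.sum_neg (fun i _ => ?_) Finset.univ_nonempty).ne hsum
      have := hpos i
      have h1 := hsq (unitSign (c i))
      simp only [Pi.neg_apply, Units.val_neg, Int.cast_neg] at this
      linear_combination this - x i * c i * h1
  · rintro ⟨h₁, h₂⟩
    set d : ι → ℝ := fun i => ((σ i : ℤ) : ℝ) * c i with hd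
    have hd0 (i) : d i ≠ 0 := mul_ne_zero (by simp) (hc i)
    obtain ⟨p, hp⟩ : ∃ i, 0 < d i := by
      by_contra! h
      refine h₂ (funext fun i => ?_)
      have : 0 < (((-σ i : ℤˣ) : ℤ) : ℝ) * c i := by
        simpa [hd] using lt_of_le_of_ne (h i) (hd0 i)
      simp [← eq_unitSign_of_mul_pos this]
    obtain ⟨q, hq⟩ : ∃ i, d i < 0 := by
      by_contra! h
      exact h₁ (funext fun i => eq_unitSign_of_mul_pos (lt_of_le_of_ne (h i) (hd0 i).symm))
    set A : ℝ := ∑ i with 0 < d i, d i with hA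
    set B : ℝ := ∑ i with ¬ 0 < d i, d i with hB
    have hApos : 0 < A :=
      Finset.sum_pos (fun i hi => (Finset.mem_filter.mp hi).2) ⟨p, by simpa using hp⟩
    have hBneg : B < 0 :=
      Finset.sum_neg (fun i hi => lt_of_le_of_ne (not_lt.mp (Finset.mem_filter.mp hi).2) (hd0 i))
        ⟨q, by simpa using hq.le⟩
    refine ⟨fun i => ((σ i : ℤ) : ℝ) * if 0 < d i then -B else A, fun i => ?_, ?_⟩
    · rw [← mul_assoc, hsq, one_mul]
      split_ifs
      · linarith
      · exact hApos
    · have hterm (i) : (((σ i : ℤ) : ℝ) * if 0 < d i then -B else A) * c i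
          = if 0 < d i then -B * d i else A * d i := by
        split_ifs <;> simp only [hd] <;> ring
      simp_rw [hterm]
      rw [Finset.sum_ite, ← Finset.mul_sum, ← Finset.mul_sum]
      change -B * A + A * B = 0
      ring

/-- The values of `k + 1` functionals in general position on a `k`-dimensional space are
exactly the solutions of one linear relation, all of whose coefficients are nonzero. -/
theorem exists_relation_of_generalPosition {V : Type*} [AddCommGroup V] [Module ℝ V]
    [FiniteDimensional ℝ V] {ι : Type*} [Fintype ι] (hι : Fintype.card ι = finrank ℝ V + 1)
    {χ : ι → V →ₗ[ℝ] ℝ} (hgp : ∀ j, ∀ t, (∀ i, i ≠ j → χ i t = 0) → t = 0) :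
    ∃ c : ι → ℝ, (∀ i, c i ≠ 0) ∧
      ∀ x : ι → ℝ, ∑ i, x i * c i = 0 ↔ ∃ t, ∀ i, χ i t = x i := by
  classical
  have : Nonempty ι := Fintype.card_pos_iff.mp (by omega)
  set L : V →ₗ[ℝ] ι → ℝ := LinearMap.pi χ with hL
  have hinj : Function.Injective L := by
    rw [← LinearMap.ker_eq_bot, LinearMap.ker_eq_bot']
    exact fun t ht => hgp (Classical.arbitrary ι) t fun i _ => congrFun ht i
  have hrank : finrank ℝ (LinearMap.range L) = finrank ℝ V := LinearMap.finrank_range_of_inj hinj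
  have hlt : LinearMap.range L < ⊤ := by
    refine lt_top_iff_ne_top.mpr fun h => ?_
    rw [h, finrank_top, finrank_fintype_fun_eq_card] at hrank
    omega
  obtain ⟨f, hf0, hle⟩ := Submodule.exists_le_ker_of_lt_top _ hlt
  have heq : LinearMap.range L = LinearMap.ker f := by
    refine Submodule.eq_of_le_of_finrank_eq hle ?_
    have h := Module.Dual.finrank_ker_add_one_of_ne_zero hf0
    rw [finrank_fintype_fun_eq_card] at h
    omega
  have hmem (x : ι → ℝ) : f x = 0 ↔ ∃ t, ∀ i, χ i t = x i := by
    rw [← LinearMap.mem_ker, ← heq, LinearMap.mem_range]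
    simp [funext_iff, hL]
  refine ⟨fun i => f (Pi.single i 1), fun j hj => ?_, fun x => ?_⟩
  · obtain ⟨t, ht⟩ := (hmem _).mp hj
    have ht0 := hgp j t fun i hi => by rw [ht, Pi.single_eq_of_ne hi]
    have := ht j
    simp [ht0] at this
  · rw [← hmem, LinearMap.pi_apply_eq_sum_univ f x]
    have hsingle (i : ι) : (fun j => if i = j then (1 : ℝ) else 0) = Pi.single i 1 := by
      ext j
      simp [Pi.single_apply, eq_comm]
    simp [hsingle]


/-- for nonzero functionals `χ i` on `ℝ^k` with distinct kernels in general
position, the complement of the union of the kernels has exactly `2^(k+1) - 2` connected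
components, and each connected component is a chamber
`{t | ∀ i, σ i * χ i t > 0}` for some sign vector `σ ∈ {-1,1}^(k+1)`. -/
theorem statement2 (k : ℕ) (hk : 2 ≤ k)
    (χ : Fin (k + 1) → ((Fin k → ℝ) →ₗ[ℝ] ℝ))
    (hne : ∀ i, χ i ≠ 0)
    (hdist : ∀ i j, i ≠ j → LinearMap.ker (χ i) ≠ LinearMap.ker (χ j))
    (hgp : ∀ S : Finset (Fin (k + 1)),
      Module.finrank ℝ ↥(⨅ i ∈ S, LinearMap.ker (χ i)) = k - S.card)
    (U : Set (Fin k → ℝ)) (hU : U = (⋃ i, (LinearMap.ker (χ i) : Set (Fin k → ℝ)))ᶜ) :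
    {C : Set (Fin k → ℝ) | ∃ t ∈ U, connectedComponentIn U t = C}.ncard
        = 2 ^ (k + 1) - 2 ∧
      ∀ t ∈ U, ∃ σ : Fin (k + 1) → ℝ, (∀ i, σ i = 1 ∨ σ i = -1) ∧
        connectedComponentIn U t = {s : Fin k → ℝ | ∀ i, 0 < σ i * χ i s} := by
  subst hU
  have hcont (i) : Continuous (χ i) := (χ i).continuous_of_finiteDimensional
  have hker (j) (t) (ht : ∀ i, i ≠ j → χ i t = 0) : t = 0 := by
    have h := hgp (Finset.univ.erase j)
    rw [Finset.card_erase_of_mem (Finset.mem_univ j), Finset.card_univ, Fintype.card_fin,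
      Nat.add_sub_cancel, Nat.sub_self, Submodule.finrank_eq_zero] at h
    rw [← Submodule.mem_bot ℝ, ← h]
    simpa [Submodule.mem_iInf] using ht
  obtain ⟨c, hc, hrel⟩ := exists_relation_of_generalPosition (by simp) hker
  set τ : Fin (k + 1) → ℤˣ := fun i => unitSign (c i)
  have hne_iff (σ : Fin (k + 1) → ℤˣ) : (signChamber χ σ).Nonempty ↔ σ ∈ ({τ, -τ} : Set _)ᶜ := by
    rw [Set.mem_compl_iff, Set.mem_insert_iff, Set.mem_singleton_iff, not_or,
      ← ne_eq, ← ne_eq, ← exists_sum_eq_zero_with_signs_iff hc]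
    constructor
    · rintro ⟨t, ht⟩
      exact ⟨fun i => χ i t, ht, (hrel _).mpr ⟨t, fun _ => rfl⟩⟩
    · rintro ⟨x, hx, hsum⟩
      obtain ⟨t, ht⟩ := (hrel x).mp hsum
      exact ⟨t, fun i => by rw [ht]; exact hx i⟩
  constructor
  · have himage : {C | ∃ t ∈ (⋃ i, (LinearMap.ker (χ i) : Set (Fin k → ℝ)))ᶜ,
        connectedComponentIn (⋃ i, (LinearMap.ker (χ i) : Set (Fin k → ℝ)))ᶜ t = C}
        = signChamber χ '' ({τ, -τ} : Set _)ᶜ := by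
      ext C
      constructor
      · rintro ⟨t, ht, rfl⟩
        have hmem := mem_signChamber_unitSign (mem_compl_iUnion_ker.mp ht)
        exact ⟨_, (hne_iff _).mp ⟨t, hmem⟩, (connectedComponentIn_eq_signChamber hcont hmem).symm⟩
      · rintro ⟨σ, hσ, rfl⟩
        obtain ⟨t, ht⟩ := (hne_iff σ).mpr hσ
        exact ⟨t, signChamber_subset χ σ ht, connectedComponentIn_eq_signChamber hcont ht⟩
    have hinj : Set.InjOn (signChamber χ) ({τ, -τ} : Set _)ᶜ := by
      intro σ hσ σ' _ h
      obtain ⟨t, ht⟩ := (hne_iff σ).mpr hσ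
      exact eq_of_mem_signChamber ht (h ▸ ht)
    have hτ : τ ≠ -τ := fun h => units_ne_neg_self (τ 0) (congrFun h 0)
    rw [himage, hinj.ncard_image, Set.ncard_compl, Set.ncard_pair hτ,
      Nat.card_eq_fintype_card, Fintype.card_fun, Fintype.card_units_int, Fintype.card_fin]
  · intro t ht
    refine ⟨fun i => ((unitSign (χ i t) : ℤ) : ℝ), fun i => ?_,
      connectedComponentIn_eq_signChamber hcont
        (mem_signChamber_unitSign (mem_compl_iUnion_ker.mp ht))⟩
    rcases Int.units_eq_one_or (unitSign (χ i t)) with h | h <;> simp [h]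
end

section
/- Let k ≥ 2 and let χ_1, …, χ_{k+1} be nonzero linear functionals on ℝ^k whose kernels are distinct hyperplanes through the origin in general position. Assume there is no t ∈ ℝ^k with χ_i(t) > 0 for all i = 1, …, k+1. Then for each i the cone C_i = {t ∈ ℝ^k : χ_i(t) < 0 and χ_j(t) > 0 for all j ≠ i} is nonempty, and there exist elements t_i ∈ C_i, i = 1, …, k+1, such that t_1 + t_2 + ⋯ + t_{k+1} = 0. -/
/-- The range of an injective linear map from `ℝ^k` to `ℝ^(k+1)` is a hyperplane,
given by a single linear equation. -/
lemma exists_coeff_mem_range_iff {k : ℕ} (Φ : (Fin k → ℝ) →ₗ[ℝ] (Fin (k + 1) → ℝ))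
    (hΦ : Function.Injective Φ) :
    ∃ a : Fin (k + 1) → ℝ, ∀ x, (∃ t, Φ t = x) ↔ ∑ j, x j * a j = 0 := by
  have hr : Module.finrank ℝ (LinearMap.range Φ) = k := by
    rw [LinearMap.finrank_range_of_inj hΦ, Module.finrank_fin_fun]
  have hlt : LinearMap.range Φ < ⊤ := by
    refine lt_top_iff_ne_top.2 fun h => ?_
    rw [h, finrank_top, Module.finrank_fin_fun] at hr
    omega
  obtain ⟨f, hf, hle⟩ := Submodule.exists_le_ker_of_lt_top _ hlt
  have hker : Module.finrank ℝ (LinearMap.ker f) = k := by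
    have h := Module.Dual.finrank_ker_add_one_of_ne_zero hf
    rw [Module.finrank_fin_fun] at h
    omega
  have heq : LinearMap.range Φ = LinearMap.ker f :=
    Submodule.eq_of_le_of_finrank_eq hle (hr.trans hker.symm)
  refine ⟨fun j => f (Pi.single j 1), fun x => ?_⟩
  rw [← LinearMap.mem_range, heq, LinearMap.mem_ker]
  conv_lhs => rw [pi_eq_sum_univ' x, map_sum]
  simp only [map_smul, smul_eq_mul]

/-- for nonzero functionals `χ 1, …, χ (k+1)` on `ℝ^k` with distinct
kernels in general position, if no `t` makes all `χ i t` positive, then each cone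
`C i = {t | χ i t < 0 ∧ ∀ j ≠ i, χ j t > 0}` is nonempty and one can choose
`t i ∈ C i` with `∑ i, t i = 0`. -/
theorem statement3 (k : ℕ) (hk : 2 ≤ k)
    (χ : Fin (k + 1) → ((Fin k → ℝ) →ₗ[ℝ] ℝ))
    (hne : ∀ i, χ i ≠ 0)
    (hdist : ∀ i j, i ≠ j → LinearMap.ker (χ i) ≠ LinearMap.ker (χ j))
    (hgp : ∀ S : Finset (Fin (k + 1)),
      Module.finrank ℝ ↥(⨅ i ∈ S, LinearMap.ker (χ i)) = k - S.card)
    (hnot : ¬ ∃ t : Fin k → ℝ, ∀ i, 0 < χ i t) :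
    (∀ i, ∃ t : Fin k → ℝ, χ i t < 0 ∧ ∀ j, j ≠ i → 0 < χ j t) ∧
      ∃ t : Fin (k + 1) → (Fin k → ℝ),
        (∀ i, χ i (t i) < 0 ∧ ∀ j, j ≠ i → 0 < χ j (t i)) ∧ ∑ i, t i = 0 := by
  have hzero (i : Fin (k + 1)) (t : Fin k → ℝ) (ht : ∀ j, j ≠ i → χ j t = 0) : t = 0 := by
    have h := hgp (Finset.univ.erase i)
    rw [Finset.card_erase_of_mem (Finset.mem_univ i), Finset.card_univ, Fintype.card_fin,
      Nat.add_sub_cancel, Nat.sub_self, Submodule.finrank_eq_zero] at h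
    rw [← Submodule.mem_bot ℝ, ← h]
    simpa using ht
  have hinj : Function.Injective (LinearMap.pi χ) := by
    refine (injective_iff_map_eq_zero _).2 fun t ht => hzero 0 t fun j _ => ?_
    simpa using congrFun ht j
  obtain ⟨a, ha⟩ := exists_coeff_mem_range_iff _ hinj
  have ha0 (i : Fin (k + 1)) : a i ≠ 0 := by
    intro hi
    obtain ⟨t, ht⟩ := (ha (Pi.single i 1)).2 (by simp [Pi.single_apply, hi])
    have ht0 : t = 0 := hzero i t fun j hj => by simpa [hj] using congrFun ht j
    simpa [ht0] using congrFun ht i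
  set S := ∑ j, a j with hS
  have hpos (m : Fin (k + 1)) : 0 < S / a m := by
    by_contra! hm
    obtain ⟨t, ht⟩ := (ha fun j => 1 - if j = m then S / a m else 0).2 (by
      simp [sub_mul, Finset.sum_sub_distrib, ← hS, div_mul_cancel₀ _ (ha0 m)])
    refine hnot ⟨t, fun j => ?_⟩
    have hj := congrFun ht j
    simp only [LinearMap.pi_apply] at hj
    rw [hj]
    split_ifs <;> linarith
  have hex (i : Fin (k + 1)) : ∃ t : Fin k → ℝ, LinearMap.pi χ t =
      fun j => S / a j * (1 - if i = j then (k + 1 : ℝ) else 0) := by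
    refine (ha _).2 ?_
    have h (j : Fin (k + 1)) : S / a j * (1 - if i = j then (k + 1 : ℝ) else 0) * a j =
        S * (1 - if i = j then (k + 1 : ℝ) else 0) := by
      have := ha0 j
      field_simp
    simp [h, ← Finset.mul_sum, Finset.sum_sub_distrib]
  choose t ht using hex
  have hval (i j : Fin (k + 1)) :
      χ j (t i) = S / a j * (1 - if i = j then (k + 1 : ℝ) else 0) := congrFun (ht i) j
  have hcone (i : Fin (k + 1)) : χ i (t i) < 0 ∧ ∀ j, j ≠ i → 0 < χ j (t i) := by
    refine ⟨?_, fun j hj => ?_⟩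
    · have hk0 : (0 : ℝ) < k := by exact_mod_cast (by omega : 0 < k)
      rw [hval, if_pos rfl]
      exact mul_neg_of_pos_of_neg (hpos i) (by linarith)
    · rw [hval, if_neg hj.symm, sub_zero, mul_one]
      exact hpos j
  refine ⟨fun i => ⟨t i, hcone i⟩, t, hcone, hinj ?_⟩
  ext j
  simp [hval, ← Finset.mul_sum, Finset.sum_sub_distrib]
end

section
/- Let χ be a linear functional on ℝ^k, let ε > 0, and let φ: ℝ^k → [0, ∞) be measurable such that N_φ(0) is finite and positive. Then the function t ↦ log N_φ(t) is well defined on all of ℝ^k and is Lipschitz continuous with Lipschitz constant ‖χ‖ + ε, where ‖χ‖ denotes the operator norm of χ; in particular |log N_φ(t) − log N_φ(t')| ≤ (‖χ‖ + ε)·‖t − t'‖ for all t, t' ∈ ℝ^k. -/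
open MeasureTheory Real

/-- The square of the `ε`-Lyapunov weighted norm:
`N_φ(t)² = ∫ φ(s+t) · exp(−2χ(s) − 2ε‖s‖) ds` (as an extended nonnegative real). -/
noncomputable def weightedNormSq {k : ℕ} (χ : EuclideanSpace ℝ (Fin k) →L[ℝ] ℝ) (ε : ℝ)
    (φ : EuclideanSpace ℝ (Fin k) → ℝ) (t : EuclideanSpace ℝ (Fin k)) : ENNReal :=
  ∫⁻ s, ENNReal.ofReal (φ (s + t) * Real.exp (-2 * χ s - 2 * ε * ‖s‖))

/-- The `ε`-Lyapunov weighted norm `N_φ(t)`. -/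
noncomputable def weightedNorm {k : ℕ} (χ : EuclideanSpace ℝ (Fin k) →L[ℝ] ℝ) (ε : ℝ)
    (φ : EuclideanSpace ℝ (Fin k) → ℝ) (t : EuclideanSpace ℝ (Fin k)) : ENNReal :=
  weightedNormSq χ ε φ t ^ (1 / 2 : ℝ)

/-- Translating the weighted square norm by `t - t'` costs at most the factor
`exp (2 (‖χ‖ + ε) ‖t - t'‖)`. -/
theorem weightedNormSq_le {k : ℕ} (χ : EuclideanSpace ℝ (Fin k) →L[ℝ] ℝ) {ε : ℝ} (hε : 0 ≤ ε)
    {φ : EuclideanSpace ℝ (Fin k) → ℝ} (hφ0 : ∀ s, 0 ≤ φ s) (t t' : EuclideanSpace ℝ (Fin k)) :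
    weightedNormSq χ ε φ t ≤
      ENNReal.ofReal (Real.exp ((‖χ‖ + ε) * ‖t - t'‖ * 2)) * weightedNormSq χ ε φ t' := by
  unfold weightedNormSq
  rw [← lintegral_const_mul' _ _ ENNReal.ofReal_ne_top, ← lintegral_add_right_eq_self _ (t' - t)]
  refine lintegral_mono fun s => ?_
  rw [← ENNReal.ofReal_mul (Real.exp_nonneg _), add_assoc, sub_add_cancel, mul_left_comm,
    ← Real.exp_add]
  refine ENNReal.ofReal_le_ofReal (mul_le_mul_of_nonneg_left (Real.exp_le_exp.2 ?_) (hφ0 _))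
  have hχ : -(‖χ‖ * ‖t - t'‖) ≤ χ (t' - t) := by
    rw [norm_sub_rev]
    exact (abs_le.1 (χ.le_opNorm (t' - t))).1
  have hs : ‖s‖ ≤ ‖s + (t' - t)‖ + ‖t - t'‖ := by
    simpa [norm_sub_rev t t'] using norm_sub_le (s + (t' - t)) (t' - t)
  rw [map_add]
  nlinarith [mul_le_mul_of_nonneg_left hs hε]

theorem weightedNorm_le {k : ℕ} (χ : EuclideanSpace ℝ (Fin k) →L[ℝ] ℝ) {ε : ℝ} (hε : 0 ≤ ε)
    {φ : EuclideanSpace ℝ (Fin k) → ℝ} (hφ0 : ∀ s, 0 ≤ φ s) (t t' : EuclideanSpace ℝ (Fin k)) :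
    weightedNorm χ ε φ t ≤
      ENNReal.ofReal (Real.exp ((‖χ‖ + ε) * ‖t - t'‖)) * weightedNorm χ ε φ t' := by
  unfold weightedNorm
  refine (ENNReal.rpow_le_rpow (weightedNormSq_le χ hε hφ0 t t') (by norm_num)).trans_eq ?_
  rw [ENNReal.mul_rpow_of_nonneg _ _ (by norm_num), ENNReal.ofReal_rpow_of_pos (Real.exp_pos _),
    ← Real.exp_mul, mul_assoc _ (2 : ℝ), mul_one_div_cancel two_ne_zero, mul_one]

/-- if `N_φ(0)` is finite and positive, then `N_φ(t)` is finite and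
positive for every `t` (so `log N_φ` is well defined on all of `ℝ^k`) and
`t ↦ log N_φ(t)` is Lipschitz with constant `‖χ‖ + ε`. -/
theorem statement6 (k : ℕ) (χ : EuclideanSpace ℝ (Fin k) →L[ℝ] ℝ) (ε : ℝ) (hε : 0 < ε)
    (φ : EuclideanSpace ℝ (Fin k) → ℝ) (hφm : Measurable φ) (hφ0 : ∀ s, 0 ≤ φ s)
    (hfin : weightedNorm χ ε φ 0 < ⊤) (hpos : 0 < weightedNorm χ ε φ 0) :
    (∀ t : EuclideanSpace ℝ (Fin k),
        0 < weightedNorm χ ε φ t ∧ weightedNorm χ ε φ t < ⊤) ∧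
      ∀ t t' : EuclideanSpace ℝ (Fin k),
        |Real.log (weightedNorm χ ε φ t).toReal
            - Real.log (weightedNorm χ ε φ t').toReal|
          ≤ (‖χ‖ + ε) * ‖t - t'‖ := by
  have hle := weightedNorm_le χ hε.le hφ0
  have hwd : ∀ t, 0 < weightedNorm χ ε φ t ∧ weightedNorm χ ε φ t < ⊤ := fun t =>
    ⟨pos_of_mul_pos_right (hpos.trans_le (hle 0 t)) zero_le,
      (hle t 0).trans_lt (ENNReal.mul_lt_top ENNReal.ofReal_lt_top hfin)⟩
  have hlog : ∀ t t', Real.log (weightedNorm χ ε φ t).toReal ≤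
      (‖χ‖ + ε) * ‖t - t'‖ + Real.log (weightedNorm χ ε φ t').toReal := fun t t' => by
    have hpos' : ∀ t, 0 < (weightedNorm χ ε φ t).toReal := fun t =>
      ENNReal.toReal_pos (hwd t).1.ne' (hwd t).2.ne
    have h := ENNReal.toReal_mono
      (ENNReal.mul_lt_top ENNReal.ofReal_lt_top (hwd t').2).ne (hle t t')
    rw [ENNReal.toReal_mul, ENNReal.toReal_ofReal (Real.exp_nonneg _)] at h
    have h' := Real.log_le_log (hpos' t) h
    rwa [Real.log_mul (Real.exp_ne_zero _) (hpos' t').ne', Real.log_exp] at h'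
  refine ⟨hwd, fun t t' => abs_sub_le_iff.2 ⟨?_, ?_⟩⟩
  · linarith [hlog t t']
  · rw [norm_sub_rev]
    linarith [hlog t' t]
end

section
/- Let Φ: ℝ × ℝ → ℝ be continuously differentiable, and suppose there are constants A ≥ 0 and B > 0 such that for all (s, g) ∈ ℝ × ℝ one has ∂Φ/∂g(s, g) ≥ B and |∂Φ/∂s(s, g)| ≤ A. If g: ℝ → ℝ is a function satisfying Φ(s, g(s)) = 0 for every s ∈ ℝ, then g is continuously differentiable and |g'(s)| ≤ A/B for all s ∈ ℝ. -/
/-- A differentiable function on `ℝ × ℝ` whose second partial derivative is positive is strictly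
increasing in its second variable. -/
theorem strictMono_snd_of_fderiv_pos {Φ : ℝ × ℝ → ℝ} (hΦ : Differentiable ℝ Φ)
    (hpos : ∀ s g : ℝ, 0 < fderiv ℝ Φ (s, g) (0, 1)) (s : ℝ) :
    StrictMono fun g => Φ (s, g) := by
  refine strictMono_of_deriv_pos fun g => ?_
  have h : HasDerivAt (fun g => Φ (s, g)) (fderiv ℝ Φ (s, g) (0, 1)) g :=
    (hΦ (s, g)).hasFDerivAt.comp_hasDerivAt g ((hasDerivAt_const g s).prodMk (hasDerivAt_id g))
  rw [h.deriv]
  exact hpos s g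

/-- A global solution `g` of `Φ (s, g s) = 0` is `C¹` when `Φ` is `C¹` with positive second
partial derivative. -/
theorem contDiff_of_apply_eq_zero {Φ : ℝ × ℝ → ℝ} (hΦ : ContDiff ℝ 1 Φ)
    (hpos : ∀ s g : ℝ, 0 < fderiv ℝ Φ (s, g) (0, 1)) {g : ℝ → ℝ}
    (hg : ∀ s, Φ (s, g s) = 0) : ContDiff ℝ 1 g := by
  refine contDiff_iff_contDiffAt.2 fun s => ?_
  have hinv : (fderiv ℝ Φ (s, g s) ∘L .inr ℝ ℝ ℝ).IsInvertible := by
    refine ⟨.unitsEquivAut ℝ (Units.mk0 _ (hpos s (g s)).ne'), ?_⟩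
    ext
    simp
  have hcd : ContDiffAt ℝ 1 Φ (s, g s) := hΦ.contDiffAt
  have hψ := hcd.contDiffAt_implicitFunction one_ne_zero hinv
  refine hψ.congr_of_eventuallyEq ?_
  filter_upwards [hcd.eventually_apply_implicitFunction one_ne_zero hinv] with t ht
  apply (strictMono_snd_of_fderiv_pos (hΦ.differentiable one_ne_zero) hpos t).injective
  simp only [hg] at ht ⊢
  exact ht.symm


/-- quantitative implicit function theorem: if `Φ : ℝ × ℝ → ℝ` is `C¹`
with `∂Φ/∂g ≥ B > 0` and `|∂Φ/∂s| ≤ A` everywhere, and `g : ℝ → ℝ` satisfies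
`Φ(s, g(s)) = 0` for all `s`, then `g` is `C¹` and `|g'(s)| ≤ A / B` for all `s`. -/
theorem statement9 (Φ : ℝ × ℝ → ℝ) (hΦ : ContDiff ℝ 1 Φ)
    (A B : ℝ) (hA : 0 ≤ A) (hB : 0 < B)
    (hg' : ∀ s g : ℝ, B ≤ fderiv ℝ Φ (s, g) (0, 1))
    (hs' : ∀ s g : ℝ, |fderiv ℝ Φ (s, g) (1, 0)| ≤ A)
    (g : ℝ → ℝ) (hg : ∀ s, Φ (s, g s) = 0) :
    ContDiff ℝ 1 g ∧ ∀ s, |deriv g s| ≤ A / B := by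
  have hgC := contDiff_of_apply_eq_zero hΦ (fun s t => hB.trans_le (hg' s t)) hg
  refine ⟨hgC, fun s => ?_⟩
  have hdg : HasDerivAt g (deriv g s) s := (hgC.differentiable one_ne_zero s).hasDerivAt
  have hchain : HasDerivAt (fun t => Φ (t, g t)) (fderiv ℝ Φ (s, g s) (1, deriv g s)) s :=
    (hΦ.differentiable one_ne_zero (s, g s)).hasFDerivAt.comp_hasDerivAt s
      ((hasDerivAt_id s).prodMk hdg)
  simp only [hg] at hchain
  have hsplit : ((1, deriv g s) : ℝ × ℝ) = (1, 0) + deriv g s • (0, 1) := by simp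
  have hzero := hchain.unique (hasDerivAt_const s 0)
  rw [hsplit, map_add, map_smul, smul_eq_mul] at hzero
  rw [le_div_iff₀ hB]
  calc |deriv g s| * B ≤ |deriv g s| * |fderiv ℝ Φ (s, g s) (0, 1)| := by
        gcongr
        exact (hg' s (g s)).trans (le_abs_self _)
    _ = |fderiv ℝ Φ (s, g s) (1, 0)| := by
        rw [← abs_mul, eq_neg_of_add_eq_zero_left hzero, abs_neg]
    _ ≤ A := hs' s (g s)
end

section
/- Let ε, δ, M > 0, K_1, K_2 ≥ 0, and ρ ∈ (0, 1]. Let f: [0, ∞) → ℝ be measurable and satisfy both |f(r)| ≤ K_1·exp(M r)·ρ^δ and |f(r)| ≤ K_2·exp(−ε r) for all r ≥ 0. Then f is Lebesgue integrable on [0, ∞) and ∫_0^∞ |f(r)| dr ≤ (K_1/M + K_2/ε)·ρ^γ, where γ = min(δ/2, εδ/(2M)). -/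
open MeasureTheory Real

/-- if a measurable `f : [0,∞) → ℝ` satisfies both
`|f(r)| ≤ K₁·exp(M r)·ρ^δ` and `|f(r)| ≤ K₂·exp(−ε r)` for all `r ≥ 0`, where
`ε, δ, M > 0`, `K₁, K₂ ≥ 0` and `0 < ρ ≤ 1`, then `f` is integrable on `[0, ∞)` and
`∫₀^∞ |f| ≤ (K₁/M + K₂/ε)·ρ^γ` with `γ = min(δ/2, εδ/(2M))`. -/
theorem statement10 (ε δ M K₁ K₂ ρ : ℝ)
    (hε : 0 < ε) (hδ : 0 < δ) (hM : 0 < M) (hK₁ : 0 ≤ K₁) (hK₂ : 0 ≤ K₂)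
    (hρ0 : 0 < ρ) (hρ1 : ρ ≤ 1)
    (f : ℝ → ℝ) (hfm : Measurable f)
    (h₁ : ∀ r : ℝ, 0 ≤ r → |f r| ≤ K₁ * Real.exp (M * r) * ρ ^ δ)
    (h₂ : ∀ r : ℝ, 0 ≤ r → |f r| ≤ K₂ * Real.exp (-ε * r)) :
    IntegrableOn f (Set.Ici 0) ∧
      (∫ r in Set.Ici (0 : ℝ), |f r|)
        ≤ (K₁ / M + K₂ / ε) * ρ ^ min (δ / 2) (ε * δ / (2 * M)) := by
  have hint : IntegrableOn f (Set.Ici 0) := by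
    have hexp : IntegrableOn (fun r : ℝ => K₂ * Real.exp (-ε * r)) (Set.Ici 0) :=
      ((integrableOn_exp_mul_Ioi (neg_lt_zero.mpr hε) 0).congr_set_ae
        Ioi_ae_eq_Ici.symm).const_mul K₂
    refine Integrable.mono' hexp hfm.aestronglyMeasurable ?_
    filter_upwards [ae_restrict_mem measurableSet_Ici] with r hr using h₂ r hr
  refine ⟨hint, ?_⟩
  have habs : IntegrableOn (fun r => |f r|) (Set.Ici 0) := hint.abs
  -- Split the half-line at the point where both bounds on `f` have comparable decay in `ρ`.
  set R : ℝ := -(δ / (2 * M)) * Real.log ρ with hR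
  have hR0 : 0 ≤ R :=
    mul_nonneg_of_nonpos_of_nonpos (neg_nonpos.mpr (by positivity))
      (Real.log_nonpos hρ0.le hρ1)
  have hsplit : ∫ r in Set.Ici (0 : ℝ), |f r|
      = (∫ r in Set.Ioc 0 R, |f r|) + ∫ r in Set.Ioi R, |f r| := by
    rw [integral_Ici_eq_integral_Ioi, ← Set.Ioc_union_Ioi_eq_Ioi hR0]
    exact setIntegral_union (Set.Ioc_disjoint_Ioi le_rfl) measurableSet_Ioi
      (habs.mono_set fun r hr => hr.1.le)
      (habs.mono_set fun r hr => hR0.trans (le_of_lt hr))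
  have hnear : ∫ r in Set.Ioc 0 R, |f r| ≤ K₁ / M * ρ ^ (δ / 2) := by
    have hexp : IntegrableOn (fun r : ℝ => K₁ * ρ ^ δ * Real.exp (M * r)) (Set.Iic R) :=
      (integrableOn_exp_mul_Iic hM R).const_mul _
    calc ∫ r in Set.Ioc 0 R, |f r|
        ≤ ∫ r in Set.Ioc 0 R, K₁ * ρ ^ δ * Real.exp (M * r) := by
          refine setIntegral_mono_on (habs.mono_set fun r hr => hr.1.le)
            (hexp.mono_set Set.Ioc_subset_Iic_self) measurableSet_Ioc fun r hr => ?_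
          exact (h₁ r hr.1.le).trans_eq (by ring)
      _ ≤ ∫ r in Set.Iic R, K₁ * ρ ^ δ * Real.exp (M * r) :=
          setIntegral_mono_set hexp (ae_of_all _ fun r => by positivity)
            Set.Ioc_subset_Iic_self.eventuallyLE
      _ = K₁ / M * (ρ ^ δ * Real.exp (M * R)) := by
          rw [integral_const_mul, integral_exp_mul_Iic hM]
          ring
      _ = K₁ / M * ρ ^ (δ / 2) := by
          rw [Real.rpow_def_of_pos hρ0, Real.rpow_def_of_pos hρ0, ← Real.exp_add, hR]
          congr 2
          field_simp
          ring
  have hfar : ∫ r in Set.Ioi R, |f r| ≤ K₂ / ε * ρ ^ (ε * δ / (2 * M)) := by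
    calc ∫ r in Set.Ioi R, |f r|
        ≤ ∫ r in Set.Ioi R, K₂ * Real.exp (-ε * r) :=
          setIntegral_mono_on (habs.mono_set fun r hr => hR0.trans (le_of_lt hr))
            ((integrableOn_exp_mul_Ioi (neg_lt_zero.mpr hε) R).const_mul K₂)
            measurableSet_Ioi fun r hr => h₂ r (hR0.trans (le_of_lt hr))
      _ = K₂ / ε * Real.exp (-ε * R) := by
          rw [integral_const_mul, integral_exp_mul_Ioi (neg_lt_zero.mpr hε)]
          field_simp
      _ = K₂ / ε * ρ ^ (ε * δ / (2 * M)) := by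
          rw [Real.rpow_def_of_pos hρ0, hR]
          congr 2
          field_simp
  calc ∫ r in Set.Ici (0 : ℝ), |f r|
      ≤ K₁ / M * ρ ^ (δ / 2) + K₂ / ε * ρ ^ (ε * δ / (2 * M)) :=
        hsplit.trans_le (add_le_add hnear hfar)
    _ ≤ K₁ / M * ρ ^ min (δ / 2) (ε * δ / (2 * M))
        + K₂ / ε * ρ ^ min (δ / 2) (ε * δ / (2 * M)) := by
        gcongr _ * ?_ + _ * ?_
        · exact Real.rpow_le_rpow_of_exponent_ge hρ0 hρ1 (min_le_left _ _)
        · exact Real.rpow_le_rpow_of_exponent_ge hρ0 hρ1 (min_le_right _ _)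
    _ = (K₁ / M + K₂ / ε) * ρ ^ min (δ / 2) (ε * δ / (2 * M)) := by ring
end

section
/- Let X be a set and let α be an action of the additive group ℝ^k on X. Let χ: ℝ^k → ℝ be a linear functional, w ∈ ℝ^k, and F: X × ℝ^k → ℝ a function satisfying the cocycle identity F(x, u + v) = F(x, u) + F(α(u)x, v) for all x ∈ X and u, v ∈ ℝ^k. Assume that for every x ∈ X and every t ∈ ℝ^k there exists a unique real number g(x, t) such that F(x, t + g(x, t)·w) = χ(t). Then the formula β(t)(x) = α(t + g(x, t)·w)(x) defines an action of the additive group ℝ^k on X, i.e. β(s + t)(x) = β(s)(β(t)(x)) for all s, t ∈ ℝ^k and x ∈ X; equivalently, g satisfies g(x, s + t) = g(x, t) + g(β(t)(x), s). -/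
/-- let `α` be an `ℝ^k`-action on a set `X`, `χ` a linear functional,
`w ∈ ℝ^k`, and `F` a cocycle over `α`. If for every `x, t` there is a unique real
`g(x,t)` with `F(x, t + g(x,t)·w) = χ(t)`, then `β(t)(x) = α(t + g(x,t)·w)(x)` is an
`ℝ^k`-action: `β(s+t)(x) = β(s)(β(t)(x))`; equivalently
`g(x, s+t) = g(x,t) + g(β(t)(x), s)`. -/
theorem statement13 {k : ℕ} {X : Type*}
    (α : (Fin k → ℝ) → X ≃ X)
    (hα0 : α 0 = Equiv.refl X)
    (hαadd : ∀ u v : Fin k → ℝ, α (u + v) = (α v).trans (α u))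
    (χ : (Fin k → ℝ) →ₗ[ℝ] ℝ) (w : Fin k → ℝ)
    (F : X → (Fin k → ℝ) → ℝ)
    (hF : ∀ (x : X) (u v : Fin k → ℝ), F x (u + v) = F x u + F (α u x) v)
    (g : X → (Fin k → ℝ) → ℝ)
    (hg : ∀ (x : X) (t : Fin k → ℝ), F x (t + g x t • w) = χ t)
    (hguniq : ∀ (x : X) (t : Fin k → ℝ) (c : ℝ), F x (t + c • w) = χ t → c = g x t)
    (β : (Fin k → ℝ) → X → X)
    (hβ : β = fun t x => α (t + g x t • w) x) :
    (∀ (s t : Fin k → ℝ) (x : X), β (s + t) x = β s (β t x)) ∧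
    (∀ (s t : Fin k → ℝ) (x : X), g x (s + t) = g x t + g (β t x) s) := by
  subst hβ
  have shift (s t : Fin k → ℝ) (a b : ℝ) :
      s + t + (a + b) • w = (t + a • w) + (s + b • w) := by
    rw [add_smul]; abel
  have g_add (s t : Fin k → ℝ) (x : X) :
      g x (s + t) = g x t + g (α (t + g x t • w) x) s := by
    refine (hguniq x (s + t) _ ?_).symm
    rw [shift, hF, hg, hg, map_add, add_comm]
  refine ⟨fun s t x => ?_, g_add⟩
  change α (s + t + g x (s + t) • w) x = α (s + g _ s • w) (α (t + g x t • w) x)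
  rw [g_add, shift, add_comm (t + _), hαadd, Equiv.trans_apply]
end
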